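/- arXiv:2306.14849 — 4 statements merged into one kernel-verified Lean document; each statement's English description precedes it below -/
import Mathlib

section
/- For every real s > 1, the Laplace transform of the Volterra function satisfies ∫₀^∞ e^{−s x} ν(x) dx = 1 / (s · log s). -/
open MeasureTheory Real

/-- The Volterra function `ν(x) = ∫₀^∞ x^s / Γ(s+1) ds` (for `x > 0`; `ν(0) = 0`). -/
noncomputable def volterra (x : ℝ) : ℝ := ∫ s in Set.Ioi (0 : ℝ), x ^ s / Real.Gamma (s + 1)

lemma integral_exp_neg_mul_rpow_div_Gamma {s t : ℝ} (hs : 0 < s) (ht : 0 < t) :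
    ∫ x in Set.Ioi (0 : ℝ), exp (-(s * x)) * (x ^ t / Gamma (t + 1)) =
      s⁻¹ * exp (-log s * t) := by
  have hG : Gamma (t + 1) ≠ 0 := (Gamma_pos_of_pos (by linarith)).ne'
  have h := integral_rpow_mul_exp_neg_mul_Ioi (a := t + 1) (by linarith) hs
  simp only [add_sub_cancel_right] at h
  calc _ = ∫ x in Set.Ioi (0 : ℝ), x ^ t * exp (-(s * x)) * (Gamma (t + 1))⁻¹ := by
        congr 1; ext x; ring
    _ = (1 / s) ^ (t + 1) := by
        rw [integral_mul_const, h, mul_assoc, mul_inv_cancel₀ hG, mul_one]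
    _ = _ := by
        rw [one_div, rpow_add_one (inv_ne_zero hs.ne'), rpow_def_of_pos (inv_pos.2 hs), log_inv,
          mul_comm]

lemma integrable_exp_neg_mul_rpow_div_Gamma {s : ℝ} (hs : 1 < s) :
    Integrable (Function.uncurry fun x t : ℝ ↦ exp (-(s * x)) * (x ^ t / Gamma (t + 1)))
      ((volume.restrict (Set.Ioi 0)).prod (volume.restrict (Set.Ioi 0))) := by
  have hs0 : 0 < s := by linarith
  rw [integrable_prod_iff']
  · constructor
    · filter_upwards [self_mem_ae_restrict measurableSet_Ioi] with t ht
      refine Integrable.of_integral_ne_zero ?_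
      simp only [Function.uncurry_apply_pair]
      rw [integral_exp_neg_mul_rpow_div_Gamma hs0 ht]
      positivity
    · refine ((integrableOn_exp_mul_Ioi (neg_lt_zero.2 (log_pos hs)) 0).const_mul s⁻¹).congr ?_
      filter_upwards [self_mem_ae_restrict measurableSet_Ioi] with t ht
      rw [← integral_exp_neg_mul_rpow_div_Gamma hs0 ht]
      refine setIntegral_congr_fun measurableSet_Ioi fun x hx ↦ ?_
      have hG : 0 < Gamma (t + 1) := Gamma_pos_of_pos (add_pos ht one_pos)
      have hx' : 0 < x := hx
      exact (norm_of_nonneg (by positivity :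
        0 ≤ exp (-(s * x)) * (x ^ t / Gamma (t + 1)))).symm
  · rw [Measure.prod_restrict]
    refine ContinuousOn.aestronglyMeasurable (continuousOn_of_forall_continuousAt ?_)
      (measurableSet_Ioi.prod measurableSet_Ioi)
    rintro ⟨x, t⟩ ⟨hx, ht⟩
    have hx' : 0 < x := hx
    have ht' : 0 < t + 1 := add_pos ht one_pos
    have hG : ContinuousAt (fun p : ℝ × ℝ ↦ Gamma (p.2 + 1)) (x, t) :=
      ContinuousAt.comp (g := Gamma) (f := fun p : ℝ × ℝ ↦ p.2 + 1)
        (differentiableAt_Gamma fun m ↦ by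
          have : (0 : ℝ) ≤ m := m.cast_nonneg
          simp only; linarith).continuousAt (by fun_prop)
    have hp : ContinuousAt (fun p : ℝ × ℝ ↦ p.1 ^ p.2) (x, t) :=
      continuousAt_rpow_of_ne (x, t) hx'.ne'
    exact ContinuousAt.mul (by fun_prop) (hp.div hG (Gamma_pos_of_pos ht').ne')

/-- For every real `s > 1`, the Laplace transform of the Volterra function satisfies
`∫₀^∞ e^{−s x} ν(x) dx = 1 / (s · log s)`. -/
theorem volterra_laplace (s : ℝ) (hs : 1 < s) :
    (∫ x in Set.Ioi (0 : ℝ), Real.exp (-(s * x)) * volterra x) = 1 / (s * Real.log s) := by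
  have hs0 : 0 < s := by linarith
  simp_rw [volterra, ← integral_const_mul]
  rw [integral_integral_swap (integrable_exp_neg_mul_rpow_div_Gamma hs),
    setIntegral_congr_fun measurableSet_Ioi
      fun t ht ↦ integral_exp_neg_mul_rpow_div_Gamma hs0 ht,
    integral_const_mul, integral_exp_mul_Ioi (neg_lt_zero.2 (log_pos hs))]
  have := (log_pos hs).ne'
  simp only [mul_zero, exp_zero]
  field_simp
end

section
/- (Ramanujan's identity) For every real x ≥ 0, ν(x) = e^x − N(x), where N(x) := ∫₀^∞ e^{−a x} / (a · (π² + (log a)²)) da. -/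
open MeasureTheory Real

/-- Ramanujan's integral `N(x) = ∫₀^∞ e^{−a x} / (a · (π² + (log a)²)) da`. -/
noncomputable def ramanujanN (x : ℝ) : ℝ :=
  ∫ a in Set.Ioi (0 : ℝ), Real.exp (-(a * x)) / (a * (Real.pi ^ 2 + (Real.log a) ^ 2))

section RamanujanIdentity

open Set Filter Topology

lemma rpow_mul_exp_neg_le_Gamma_add_one {A s : ℝ} (hA : 0 < A) (hs : 0 ≤ s) :
    A ^ s * exp (-A) ≤ Gamma (s + 1) := by
  have hint := Real.GammaIntegral_convergent (s := s + 1) (by linarith)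
  rw [Real.Gamma_eq_integral (by linarith)]
  calc A ^ s * exp (-A) = ∫ t in Ioi A, exp (-t) * A ^ s := by
        rw [integral_mul_const, integral_exp_neg_Ioi, mul_comm]
    _ ≤ ∫ t in Ioi A, exp (-t) * t ^ (s + 1 - 1) := by
        refine setIntegral_mono_on ?_ (hint.mono_set (Ioi_subset_Ioi hA.le)) measurableSet_Ioi ?_
        · exact (integrableOn_exp_neg_Ioi A).mul_const _
        · intro t ht
          have ht : A < t := ht
          rw [add_sub_cancel_right]
          gcongr
    _ ≤ ∫ t in Ioi 0, exp (-t) * t ^ (s + 1 - 1) := by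
        refine setIntegral_mono_set hint ?_ (Ioi_subset_Ioi hA.le).eventuallyLE
        filter_upwards [ae_restrict_mem measurableSet_Ioi] with t ht
        have ht : 0 < t := ht
        positivity

lemma rpow_div_Gamma_add_one_le {x M s : ℝ} (hx : 0 ≤ x) (hxM : x ≤ M) (hM : 0 < M)
    (hs : 0 ≤ s) : x ^ s / Gamma (s + 1) ≤ exp (exp 1 * M) * exp (-s) := by
  rw [div_le_iff₀ (Gamma_pos_of_pos (by linarith))]
  calc x ^ s ≤ M ^ s := by gcongr
    _ = exp (exp 1 * M) * exp (-s) * ((exp 1 * M) ^ s * exp (-(exp 1 * M))) := by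
        rw [mul_rpow (exp_pos 1).le hM.le, exp_one_rpow, exp_neg, exp_neg]
        field_simp
    _ ≤ _ := by
        gcongr
        exact rpow_mul_exp_neg_le_Gamma_add_one (by positivity) hs

lemma aestronglyMeasurable_rpow_div_Gamma_add_one (x : ℝ) :
    AEStronglyMeasurable (fun s : ℝ ↦ x ^ s / Gamma (s + 1)) (volume.restrict (Ioi 0)) := by
  have hc : ContinuousOn (fun s : ℝ ↦ Gamma (s + 1)) (Ioi 0) :=
    differentiableOn_Gamma_Ioi.continuousOn.comp (by fun_prop)
      fun s (hs : 0 < s) ↦ mem_Ioi.2 (by linarith)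
  exact ((measurable_const.pow measurable_id).aemeasurable.div
    (hc.aemeasurable measurableSet_Ioi)).aestronglyMeasurable

lemma norm_rpow_div_Gamma_add_one_le {x M s : ℝ} (hx : 0 ≤ x) (hxM : x ≤ M) (hM : 0 < M)
    (hs : 0 ≤ s) : ‖x ^ s / Gamma (s + 1)‖ ≤ exp (exp 1 * M) * exp (-s) := by
  have := Gamma_pos_of_pos (show 0 < s + 1 by linarith)
  rw [norm_of_nonneg (by positivity)]
  exact rpow_div_Gamma_add_one_le hx hxM hM hs

lemma integrableOn_rpow_div_Gamma_add_one {x : ℝ} (hx : 0 < x) :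
    IntegrableOn (fun s : ℝ ↦ x ^ s / Gamma (s + 1)) (Ioi 0) := by
  refine Integrable.mono' ((integrableOn_exp_neg_Ioi 0).const_mul (exp (exp 1 * x)))
    (aestronglyMeasurable_rpow_div_Gamma_add_one x) ?_
  filter_upwards [ae_restrict_mem measurableSet_Ioi] with s hs
  exact norm_rpow_div_Gamma_add_one_le hx.le le_rfl hx (le_of_lt hs)

lemma continuousOn_volterra {M : ℝ} (hM : 0 < M) : ContinuousOn volterra (Icc 0 M) := by
  refine continuousOn_of_dominated (bound := fun s ↦ exp (exp 1 * M) * exp (-s))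
    (fun x _ ↦ aestronglyMeasurable_rpow_div_Gamma_add_one x) (fun x hx ↦ ?_)
    ((integrableOn_exp_neg_Ioi 0).const_mul _) ?_
  · filter_upwards [ae_restrict_mem measurableSet_Ioi] with s hs
    exact norm_rpow_div_Gamma_add_one_le hx.1 hx.2 hM (le_of_lt hs)
  · filter_upwards [ae_restrict_mem measurableSet_Ioi] with s hs
    exact ((continuous_rpow_const (le_of_lt hs)).div_const _).continuousOn

lemma volterra_zero : volterra 0 = 0 := by
  refine setIntegral_eq_zero_of_forall_eq_zero fun s (hs : 0 < s) ↦ ?_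
  rw [zero_rpow hs.ne', zero_div]

lemma integrableOn_mul_exp_neg_Ioi : IntegrableOn (fun s : ℝ ↦ s * exp (-s)) (Ioi 0) := by
  refine (Real.GammaIntegral_convergent (s := 2) two_pos).congr_fun (fun s _ ↦ ?_)
    measurableSet_Ioi
  norm_num [mul_comm]

lemma mul_rpow_sub_one_div_Gamma_add_one {x s : ℝ} (hs : s ≠ 0) :
    s * x ^ (s - 1) / Gamma (s + 1) = x ^ (s - 1) / Gamma s := by
  rw [Gamma_add_one hs, mul_div_mul_left _ _ hs]

/-- The derivative of the Volterra function, as an integral, with its integrability. -/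
lemma hasDerivAt_volterra_integral {x : ℝ} (hx : 0 < x) :
    IntegrableOn (fun s : ℝ ↦ x ^ (s - 1) / Gamma s) (Ioi 0) ∧
      HasDerivAt volterra (∫ s in Ioi 0, x ^ (s - 1) / Gamma s) x := by
  have key : ∀ s ∈ Ioi (0 : ℝ), ∀ y : ℝ, 0 < y →
      y ^ (s - 1) / Gamma s = y⁻¹ * (s * (y ^ s / Gamma (s + 1))) := by
    intro s (hs : 0 < s) y hy
    rw [← mul_rpow_sub_one_div_Gamma_add_one hs.ne', rpow_sub_one hy.ne']
    ring
  refine hasDerivAt_integral_of_dominated_loc_of_deriv_le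
    (F := fun x s ↦ x ^ s / Gamma (s + 1)) (F' := fun x s ↦ x ^ (s - 1) / Gamma s)
    (bound := fun s ↦ (x / 2)⁻¹ * (exp (exp 1 * (2 * x)) * (s * exp (-s))))
    (Ioo_mem_nhds (show x / 2 < x by linarith) (show x < 2 * x by linarith))
    (.of_forall aestronglyMeasurable_rpow_div_Gamma_add_one)
    (integrableOn_rpow_div_Gamma_add_one hx) ?_ ?_
    ((integrableOn_mul_exp_neg_Ioi.const_mul _).const_mul _) ?_
  · refine AEStronglyMeasurable.congr (f := fun s ↦ x⁻¹ * (s * (x ^ s / Gamma (s + 1)))) ?_ ?_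
    · exact (aestronglyMeasurable_id.mul
        (aestronglyMeasurable_rpow_div_Gamma_add_one x)).const_mul _
    · filter_upwards [ae_restrict_mem measurableSet_Ioi] with s hs
      exact (key s hs x hx).symm
  · filter_upwards [ae_restrict_mem measurableSet_Ioi] with s hs y hy
    have hy0 : 0 < y := by linarith [hy.1]
    have hs0 : 0 < s := hs
    rw [key s hs y hy0, norm_mul, norm_mul, norm_of_nonneg (inv_nonneg.2 hy0.le),
      norm_of_nonneg hs0.le]
    calc y⁻¹ * (s * ‖y ^ s / Gamma (s + 1)‖)
        ≤ (x / 2)⁻¹ * (s * (exp (exp 1 * (2 * x)) * exp (-s))) := by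
          gcongr
          · exact hy.1.le
          · exact norm_rpow_div_Gamma_add_one_le hy0.le hy.2.le (by linarith) hs0.le
      _ = _ := by ring
  · filter_upwards [ae_restrict_mem measurableSet_Ioi] with s hs y hy
    have hy0 : 0 < y := by linarith [hy.1]
    have hs0 : 0 < s := hs
    rw [← mul_rpow_sub_one_div_Gamma_add_one hs0.ne']
    exact (hasDerivAt_rpow_const (Or.inl hy0.ne')).div_const _

lemma hasDerivAt_volterra {x : ℝ} (hx : 0 < x) :
    HasDerivAt volterra (volterra x + ∫ s in Ioc 0 1, x ^ (s - 1) / Gamma s) x := by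
  obtain ⟨hint, hder⟩ := hasDerivAt_volterra_integral hx
  convert hder using 1
  have hshift : ∫ s in Ioi 1, x ^ (s - 1) / Gamma s = volterra x := by
    have := (measurePreserving_sub_right (volume : Measure ℝ) 1).setIntegral_preimage_emb
      (MeasurableEquiv.subRight (1 : ℝ)).measurableEmbedding
      (fun s : ℝ ↦ x ^ s / Gamma (s + 1)) (Ioi 0)
    simpa [volterra] using this
  rw [← Ioc_union_Ioi_eq_Ioi zero_le_one, setIntegral_union
    (Ioc_disjoint_Ioi le_rfl) measurableSet_Ioi
    (hint.mono_set Ioc_subset_Ioi_self) (hint.mono_set (Ioi_subset_Ioi zero_le_one)), hshift,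
    add_comm]

lemma integrable_inv_pi_sq_add_sq : Integrable fun u : ℝ ↦ (π ^ 2 + u ^ 2)⁻¹ := by
  refine ((integrable_inv_one_add_sq.comp_div pi_ne_zero).const_mul (π ^ 2)⁻¹).congr
    (.of_forall fun u ↦ ?_)
  have := pi_pos
  field_simp

lemma integral_inv_pi_sq_add_sq : ∫ u : ℝ, (π ^ 2 + u ^ 2)⁻¹ = 1 := by
  have h := Measure.integral_comp_div (fun u : ℝ ↦ (1 + u ^ 2)⁻¹) π
  have hpi := pi_pos
  rw [integral_univ_inv_one_add_sq, abs_of_pos hpi, smul_eq_mul] at h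
  have : ∀ u : ℝ, (π ^ 2 + u ^ 2)⁻¹ = (π ^ 2)⁻¹ * (1 + (u / π) ^ 2)⁻¹ := fun u ↦ by
    field_simp
  simp_rw [this]
  rw [integral_const_mul, h]
  field_simp

lemma integrableOn_one_div_mul_pi_sq_add_log_sq :
    IntegrableOn (fun a : ℝ ↦ 1 / (a * (π ^ 2 + log a ^ 2))) (Ioi 0) := by
  rw [← range_exp, ← image_univ, integrableOn_image_iff_integrableOn_abs_deriv_smul
    MeasurableSet.univ (fun u _ ↦ (hasDerivAt_exp u).hasDerivWithinAt) exp_injective.injOn,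
    integrableOn_univ]
  refine integrable_inv_pi_sq_add_sq.congr (.of_forall fun u ↦ ?_)
  have := pi_pos
  simp only [abs_exp, log_exp, smul_eq_mul]
  field_simp

lemma ramanujanN_zero : ramanujanN 0 = 1 := by
  rw [ramanujanN, ← range_exp, ← image_univ, integral_image_eq_integral_abs_deriv_smul
    MeasurableSet.univ (fun u _ ↦ (hasDerivAt_exp u).hasDerivWithinAt) exp_injective.injOn,
    setIntegral_univ, ← integral_inv_pi_sq_add_sq]
  congr with u
  have := pi_pos
  simp only [abs_exp, log_exp, smul_eq_mul, mul_zero, neg_zero, exp_zero]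
  field_simp

lemma norm_exp_div_mul_le {a x : ℝ} (ha : 0 < a) (hx : 0 ≤ x) :
    ‖exp (-(a * x)) / (a * (π ^ 2 + log a ^ 2))‖ ≤ 1 / (a * (π ^ 2 + log a ^ 2)) := by
  have := pi_pos
  rw [norm_of_nonneg (by positivity)]
  gcongr
  exact exp_le_one_iff.2 (by simp only [Left.neg_nonpos_iff]; positivity)

lemma measurable_exp_div_mul (x : ℝ) :
    Measurable fun a : ℝ ↦ exp (-(a * x)) / (a * (π ^ 2 + log a ^ 2)) := by
  fun_prop

lemma integrableOn_exp_div_mul {x : ℝ} (hx : 0 ≤ x) :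
    IntegrableOn (fun a : ℝ ↦ exp (-(a * x)) / (a * (π ^ 2 + log a ^ 2))) (Ioi 0) := by
  refine Integrable.mono' integrableOn_one_div_mul_pi_sq_add_log_sq
    (measurable_exp_div_mul x).aestronglyMeasurable ?_
  filter_upwards [ae_restrict_mem measurableSet_Ioi] with a ha
  exact norm_exp_div_mul_le ha hx

lemma continuousOn_ramanujanN : ContinuousOn ramanujanN (Ici 0) := by
  refine continuousOn_of_dominated (bound := fun a ↦ 1 / (a * (π ^ 2 + log a ^ 2)))
    (fun x _ ↦ (measurable_exp_div_mul x).aestronglyMeasurable) (fun x hx ↦ ?_)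
    integrableOn_one_div_mul_pi_sq_add_log_sq ?_
  · filter_upwards [ae_restrict_mem measurableSet_Ioi] with a ha
    exact norm_exp_div_mul_le ha hx
  · exact .of_forall fun a ↦ by fun_prop

lemma hasDerivAt_ramanujanN {x : ℝ} (hx : 0 < x) :
    IntegrableOn (fun a : ℝ ↦ -(exp (-(a * x)) / (π ^ 2 + log a ^ 2))) (Ioi 0) ∧
      HasDerivAt ramanujanN (∫ a in Ioi 0, -(exp (-(a * x)) / (π ^ 2 + log a ^ 2))) x := by
  refine hasDerivAt_integral_of_dominated_loc_of_deriv_le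
    (F := fun x a ↦ exp (-(a * x)) / (a * (π ^ 2 + log a ^ 2)))
    (F' := fun x a ↦ -(exp (-(a * x)) / (π ^ 2 + log a ^ 2)))
    (bound := fun a ↦ exp (-(x / 2) * a) / π ^ 2)
    (Ioi_mem_nhds (show x / 2 < x by linarith))
    (.of_forall fun x ↦ (measurable_exp_div_mul x).aestronglyMeasurable)
    (integrableOn_exp_div_mul hx.le)
    (Measurable.aestronglyMeasurable (by fun_prop)) ?_
    ((exp_neg_integrableOn_Ioi 0 (half_pos hx)).div_const _) ?_
  · filter_upwards [ae_restrict_mem measurableSet_Ioi] with a ha y hy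
    have ha : 0 < a := ha
    have hy : x / 2 < y := hy
    have := pi_pos
    rw [norm_neg, norm_of_nonneg (by positivity)]
    gcongr
    · nlinarith
    · nlinarith [sq_nonneg (log a)]
  · filter_upwards [ae_restrict_mem measurableSet_Ioi] with a ha y hy
    have ha : 0 < a := ha
    have := pi_pos
    refine (((hasDerivAt_id y).const_mul a).neg.exp.div_const
      (a * (π ^ 2 + log a ^ 2))).congr_deriv ?_
    simp only [id, Pi.neg_apply]
    field_simp

lemma integral_rpow_neg_mul_sin {a : ℝ} (ha : 0 < a) :
    ∫ s in Ioc (0 : ℝ) 1, a ^ (-s) * sin (π * s) / π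
      = (1 + a⁻¹) / (π ^ 2 + log a ^ 2) := by
  have hpi := pi_pos
  set L := log a
  have hexp : ∀ s : ℝ, a ^ (-s) = exp (L * -s) := fun s ↦ rpow_def_of_pos ha _
  have hder : ∀ s ∈ uIcc (0 : ℝ) 1, HasDerivAt
      (fun s ↦ -(exp (L * -s) * (L * sin (π * s) + π * cos (π * s))) / (π * (π ^ 2 + L ^ 2)))
      (exp (L * -s) * sin (π * s) / π) s := by
    intro s _
    have hs : HasDerivAt (fun s : ℝ ↦ π * s) π s := by
      simpa using (hasDerivAt_id s).const_mul π
    have he : HasDerivAt (fun s : ℝ ↦ exp (L * -s)) (exp (L * -s) * (-L)) s := by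
      simpa using ((hasDerivAt_id s).neg.const_mul L).exp
    refine ((he.mul ((hs.sin.const_mul L).add (hs.cos.const_mul π))).neg.div_const
      (π * (π ^ 2 + L ^ 2))).congr_deriv ?_
    simp only [Pi.add_apply]
    field_simp
    ring
  simp_rw [hexp]
  rw [← intervalIntegral.integral_of_le zero_le_one,
    intervalIntegral.integral_eq_sub_of_hasDerivAt hder
      (Continuous.intervalIntegrable (by fun_prop) _ _)]
  have h1 : exp (L * -1) = a⁻¹ := by rw [mul_neg_one, exp_neg, exp_log ha]
  rw [h1]
  simp
  field_simp
  ring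

lemma integral_rpow_neg_mul_exp {x s : ℝ} (hx : 0 < x) (hs : 0 < s) (hs1 : s < 1) :
    ∫ a in Ioi (0 : ℝ), a ^ (-s) * sin (π * s) / π * exp (-(x * a))
      = x ^ (s - 1) / Gamma s := by
  have h := integral_rpow_mul_exp_neg_mul_Ioi (a := 1 - s) (r := x) (by linarith) hx
  have hsin : 0 < sin (π * s) :=
    sin_pos_of_pos_of_lt_pi (by have := pi_pos; positivity) (by nlinarith [pi_pos])
  have hG := Real.Gamma_mul_Gamma_one_sub s
  have hGs := Gamma_pos_of_pos hs
  have hpi := pi_pos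
  rw [sub_sub_cancel_left, one_div, inv_rpow hx.le, ← rpow_neg hx.le, neg_sub] at h
  calc _ = ∫ a in Ioi (0 : ℝ), sin (π * s) / π * (a ^ (-s) * exp (-(x * a))) := by
        congr with a; ring
    _ = _ := by
        rw [integral_const_mul, h]
        have : Gamma (1 - s) = π / sin (π * s) / Gamma s := by
          rw [← hG]; field_simp
        rw [this]
        field_simp

lemma integral_rpow_sub_one_div_Gamma {x : ℝ} (hx : 0 < x) :
    ∫ s in Ioc 0 1, x ^ (s - 1) / Gamma s
      = ∫ a in Ioi 0, (1 + a⁻¹) / (π ^ 2 + log a ^ 2) * exp (-(x * a)) := by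
  have hae : ∀ᵐ s ∂volume.restrict (Ioc (0 : ℝ) 1), 0 < s ∧ s < 1 := by
    rw [← restrict_Ioo_eq_restrict_Ioc]
    exact ae_restrict_mem measurableSet_Ioo
  have hint : Integrable
      (Function.uncurry fun s a : ℝ ↦ a ^ (-s) * sin (π * s) / π * exp (-(x * a)))
      ((volume.restrict (Ioc 0 1)).prod (volume.restrict (Ioi 0))) := by
    rw [integrable_prod_iff
      (Measurable.aestronglyMeasurable (by unfold Function.uncurry; fun_prop))]
    constructor
    · filter_upwards [hae] with s hs
      have := (integrableOn_rpow_mul_exp_neg_mul_rpow (p := 1) (s := -s) (b := x) (by linarith)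
        one_pos hx).const_mul (sin (π * s) / π)
      refine this.congr (.of_forall fun a ↦ ?_)
      simp only [Function.uncurry, rpow_one, neg_mul]
      ring
    · refine ((hasDerivAt_volterra_integral hx).1.mono_set Ioc_subset_Ioi_self).congr ?_
      filter_upwards [hae] with s hs
      rw [← integral_rpow_neg_mul_exp hx hs.1 hs.2]
      refine setIntegral_congr_fun measurableSet_Ioi fun a (ha : 0 < a) ↦ ?_
      have hsin : 0 < sin (π * s) :=
        sin_pos_of_pos_of_lt_pi (mul_pos pi_pos hs.1) (by nlinarith [pi_pos])
      have := pi_pos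
      exact (norm_of_nonneg (by positivity)).symm
  calc _ = ∫ s in Ioc (0 : ℝ) 1, ∫ a in Ioi (0 : ℝ),
        a ^ (-s) * sin (π * s) / π * exp (-(x * a)) := by
        refine integral_congr_ae ?_
        filter_upwards [hae] with s hs
        exact (integral_rpow_neg_mul_exp hx hs.1 hs.2).symm
    _ = _ := by
        rw [integral_integral_swap hint]
        refine setIntegral_congr_fun measurableSet_Ioi fun a ha ↦ ?_
        simp only [integral_mul_const]
        rw [integral_rpow_neg_mul_sin ha]

lemma hasDerivAt_volterra_add_ramanujanN {x : ℝ} (hx : 0 < x) :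
    HasDerivAt (fun y ↦ volterra y + ramanujanN y) (volterra x + ramanujanN x) x := by
  obtain ⟨hint, hder⟩ := hasDerivAt_ramanujanN hx
  refine ((hasDerivAt_volterra hx).add hder).congr_deriv ?_
  have hN : ramanujanN x = (∫ s in Ioc 0 1, x ^ (s - 1) / Gamma s)
      + ∫ a in Ioi 0, -(exp (-(a * x)) / (π ^ 2 + log a ^ 2)) := by
    have hadd := integral_sub (integrableOn_exp_div_mul hx.le) hint
    rw [← sub_eq_iff_eq_add, integral_rpow_sub_one_div_Gamma hx]
    refine hadd.symm.trans (setIntegral_congr_fun measurableSet_Ioi fun a (ha : 0 < a) ↦ ?_)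
    have := pi_pos
    simp only [mul_comm x a]
    field_simp
    ring
  rw [hN, add_assoc]

lemma volterra_add_ramanujanN {x : ℝ} (hx : 0 ≤ x) : volterra x + ramanujanN x = exp x := by
  rcases hx.eq_or_lt with rfl | hx
  · rw [volterra_zero, ramanujanN_zero, exp_zero, zero_add]
  obtain ⟨c, hc, hslope⟩ := exists_hasDerivAt_eq_slope
    (fun y ↦ exp (-y) * (volterra y + ramanujanN y)) (fun _ ↦ 0) hx
    ((by fun_prop : ContinuousOn (fun y : ℝ ↦ exp (-y)) (Icc 0 x)).mul
      ((continuousOn_volterra hx).add (continuousOn_ramanujanN.mono Icc_subset_Ici_self)))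
    fun y hy ↦ by
      refine ((hasDerivAt_neg y).exp.mul
        (hasDerivAt_volterra_add_ramanujanN hy.1)).congr_deriv ?_
      ring
  rw [eq_comm, div_eq_zero_iff, or_iff_left (by linarith), sub_eq_zero, volterra_zero,
    ramanujanN_zero, neg_zero, exp_zero, zero_add, mul_one, exp_neg] at hslope
  field_simp at hslope
  exact hslope

end RamanujanIdentity

/-- Ramanujan's identity: for every `x ≥ 0`, `ν(x) = e^x − N(x)`. -/
theorem volterra_eq_exp_sub_ramanujanN (x : ℝ) (hx : 0 ≤ x) :
    volterra x = Real.exp x - ramanujanN x :=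
  eq_sub_of_add_eq (volterra_add_ramanujanN hx)
end

section
/- As x → 0⁺ one has the asymptotic expansion ν(x) = 1/log(1/x) + γ_EM/(log(1/x))² + (γ_EM² − π²/6)/(log(1/x))³ + O(1/(log(1/x))⁴); that is, the function x ↦ ν(x) − 1/log(1/x) − γ_EM/(log(1/x))² − (γ_EM² − π²/6)/(log(1/x))³ is big-O of (log(1/x))^{−4} as x tends to 0 from the right. -/
open MeasureTheory Real Asymptotics

/-- The Euler–Mascheroni constant `γ_EM = −∫₀^∞ e^{−x} log x dx`. -/
noncomputable def eulerGamma : ℝ := -∫ x in Set.Ioi (0 : ℝ), Real.exp (-x) * Real.log x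

/-- The Euler–Mascheroni constant given by the logarithmic integral agrees with Mathlib's. -/
lemma eulerGamma_eq_eulerMascheroniConstant : eulerGamma = eulerMascheroniConstant := by
  have h := Complex.hasDerivAt_GammaIntegral (s := 1) (by simp)
  have h2 : HasDerivAt Complex.GammaIntegral (-(eulerMascheroniConstant : ℂ)) 1 := by
    refine Complex.hasDerivAt_Gamma_one.congr_of_eventuallyEq ?_
    have : {s : ℂ | 0 < s.re} ∈ nhds (1 : ℂ) :=
      (isOpen_lt continuous_const Complex.continuous_re).mem_nhds (by simp)
    filter_upwards [this] with s hs using (Complex.Gamma_eq_integral hs).symm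
  have h3 := h.unique h2
  have h4 : (∫ t : ℝ in Set.Ioi 0, (t : ℂ) ^ ((1 : ℂ) - 1) * (Real.log t * Real.exp (-t)))
      = ((∫ t : ℝ in Set.Ioi 0, Real.exp (-t) * Real.log t : ℝ) : ℂ) := by
    rw [← integral_complex_ofReal]
    congr 1
    ext t
    simp [mul_comm]
  rw [h4] at h3
  have h5 : (∫ t : ℝ in Set.Ioi 0, Real.exp (-t) * Real.log t) = -eulerMascheroniConstant := by
    exact_mod_cast h3
  rw [eulerGamma, h5, neg_neg]

lemma analyticAt_inv_Gamma_add_one : AnalyticAt ℝ (fun s : ℝ => (Gamma (s + 1))⁻¹) 0 := by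
  have hd : Differentiable ℂ fun s : ℂ => (Complex.Gamma (s + 1))⁻¹ :=
    Complex.differentiable_one_div_Gamma.comp (differentiable_id.add_const 1)
  refine (hd.analyticAt ((0 : ℝ) : ℂ)).re_ofReal.congr (Filter.Eventually.of_forall fun s => ?_)
  have : (Complex.Gamma (s + 1))⁻¹ = (((Gamma (s + 1))⁻¹ : ℝ) : ℂ) := by
    rw [Complex.ofReal_inv, ← Complex.Gamma_ofReal]; push_cast; rfl
  simp only [this, Complex.ofReal_re]

/-- A real analytic function at `0` agrees with its quadratic Taylor polynomial up to a cubic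
error. -/
lemma AnalyticAt.exists_isBigO_sub_quadratic {f : ℝ → ℝ} (hf : AnalyticAt ℝ f 0) :
    ∃ c : ℝ, (fun s => f s - (f 0 + deriv f 0 * s + c * s ^ 2)) =O[nhds 0] fun s => s ^ 3 := by
  obtain ⟨p, hp⟩ := hf
  refine ⟨p.coeff 2, ?_⟩
  have h := hp.isBigO_sub_partialSum_pow 3
  have h0 : p.coeff 0 = f 0 := hp.coeff_zero _
  have h1 : p.coeff 1 = deriv f 0 := hp.deriv.symm
  simp only [zero_add, FormalMultilinearSeries.partialSum, Finset.sum_range_succ,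
    Finset.sum_range_zero, FormalMultilinearSeries.apply_eq_pow_smul_coeff, smul_eq_mul,
    h0, h1] at h
  refine (h.congr_left fun s => ?_).trans (IsBigO.of_bound 1 ?_)
  · ring
  · filter_upwards with s
    simp

lemma eq_zero_of_const_mul_pow_isBigO {K : ℝ}
    (h : (fun s : ℝ => K * s ^ 3) =O[nhds 0] fun s => s ^ 4) : K = 0 := by
  by_contra hK
  have h1 : (fun s : ℝ => s ^ 4) =o[nhds 0] fun s : ℝ => K * s ^ 3 :=
    (isLittleO_pow_pow (by norm_num)).const_mul_right hK
  have h2 := (h.trans_isLittleO h1)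
  refine isLittleO_irrefl ?_ h2
  have : ∃ᶠ s in nhdsWithin (0 : ℝ) {0}ᶜ, K * s ^ 3 ≠ 0 := by
    refine Filter.Eventually.frequently ?_
    filter_upwards [self_mem_nhdsWithin] with s hs
    exact mul_ne_zero hK (pow_ne_zero _ hs)
  exact this.filter_mono nhdsWithin_le_nhds

lemma sin_pi_mul_div_pi_isBigO :
    (fun s : ℝ => sin (π * s) / π - (s - π ^ 2 / 6 * s ^ 3)) =O[nhds 0] fun s => s ^ 5 := by
  refine IsBigO.of_bound (π ^ 5 / 100 / π) ?_
  have hc : Filter.Tendsto (fun s : ℝ => |π * s|) (nhds 0) (nhds 0) := by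
    have : Continuous fun s : ℝ => |π * s| := by fun_prop
    simpa using this.tendsto 0
  filter_upwards [hc.eventually_le_const one_pos] with s hs
  have h := Real.sin_bound hs
  have e : sin (π * s) / π - (s - π ^ 2 / 6 * s ^ 3)
      = (sin (π * s) - (π * s - (π * s) ^ 3 / 6)) / π := by
    field_simp
  rw [e, norm_div, Real.norm_of_nonneg pi_pos.le, Real.norm_eq_abs, Real.norm_eq_abs, abs_pow]
  rw [abs_mul, abs_of_pos pi_pos] at h
  calc _ ≤ (π * |s|) ^ 5 / 100 / π := by gcongr
    _ = _ := by ring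

lemma inv_Gamma_add_one_mul_inv_Gamma_one_sub (s : ℝ) :
    s * ((Gamma (s + 1))⁻¹ * (Gamma (-s + 1))⁻¹) = sin (π * s) / π := by
  rcases eq_or_ne s 0 with rfl | hs
  · simp
  · have h := Gamma_mul_Gamma_one_sub s
    rw [Gamma_add_one hs, neg_add_eq_sub, ← mul_inv, mul_assoc, h, mul_inv, ← mul_assoc,
      mul_inv_cancel₀ hs, one_mul, inv_div]

/-- The quadratic Taylor expansion of the reciprocal Gamma function at `1`. -/
lemma inv_Gamma_add_one_sub_quadratic_isBigO :
    (fun s : ℝ => (Gamma (s + 1))⁻¹ - (1 + eulerGamma * s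
      + (eulerGamma ^ 2 - π ^ 2 / 6) / 2 * s ^ 2)) =O[nhds 0] fun s => s ^ 3 := by
  obtain ⟨c, hc⟩ := analyticAt_inv_Gamma_add_one.exists_isBigO_sub_quadratic
  have hd : deriv (fun s : ℝ => (Gamma (s + 1))⁻¹) 0 = eulerGamma := by
    have h : HasDerivAt Gamma (-eulerMascheroniConstant) (0 + 1) := by
      simpa using hasDerivAt_Gamma_one
    have := ((h.comp_add_const (0 : ℝ) 1).fun_inv (by simp)).deriv
    simpa [eulerGamma_eq_eulerMascheroniConstant] using this
  simp only [hd, zero_add, Gamma_one, inv_one] at hc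
  set g := eulerGamma
  have hneg : Filter.Tendsto (fun s : ℝ => -s) (nhds 0) (nhds 0) := by
    simpa using (continuous_neg (G := ℝ)).tendsto 0
  have hc' : (fun s : ℝ => (Gamma (-s + 1))⁻¹ - (1 - g * s + c * s ^ 2))
      =O[nhds 0] fun s => s ^ 3 := by
    refine ((hc.comp_tendsto hneg).congr_left fun s => ?_).trans (IsBigO.of_bound 1 ?_)
    · simp only [Function.comp_apply]; ring
    · filter_upwards with s
      simp
  have hP : (fun s : ℝ => 1 - g * s + c * s ^ 2) =O[nhds 0] fun _ => (1 : ℝ) :=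
    (by fun_prop : Continuous fun s : ℝ => 1 - g * s + c * s ^ 2).continuousAt.isBigO_one ℝ
  have hf : (fun s : ℝ => (Gamma (s + 1))⁻¹) =O[nhds 0] fun _ => (1 : ℝ) :=
    analyticAt_inv_Gamma_add_one.continuousAt.isBigO_one ℝ
  have hid : (fun s : ℝ => s) =O[nhds 0] fun s => s := isBigO_refl _ _
  have hA := hid.mul ((hc.mul hP).add ((hf.mul hc').congr_right fun s => mul_comm _ _))
  have h5 : (fun s : ℝ => s ^ 5) =O[nhds 0] fun s => s ^ 4 :=
    (isLittleO_pow_pow (by norm_num)).isBigO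
  have hK := ((sin_pi_mul_div_pi_isBigO.trans h5).sub
    (hA.congr_right (g₂ := fun s : ℝ => s ^ 4) fun s => by ring)).sub (h5.const_mul_left (c ^ 2))
  have hK0 := eq_zero_of_const_mul_pow_isBigO (K := 2 * c - g ^ 2 + π ^ 2 / 6)
    (hK.congr_left fun s => by
      rw [← inv_Gamma_add_one_mul_inv_Gamma_one_sub]; ring)
  have hc2 : c = (g ^ 2 - π ^ 2 / 6) / 2 := by linarith
  rwa [hc2] at hc

lemma exists_inv_Gamma_le : ∃ B : ℝ, ∀ s : ℝ, 0 < s → (Gamma s)⁻¹ ≤ B := by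
  obtain ⟨x, hx, hmin⟩ := exists_isMinOn_Gamma_Ioi
  have hx0 : 0 < Gamma x := Gamma_pos_of_pos (by linarith [hx.1])
  exact ⟨(Gamma x)⁻¹, fun s hs => inv_anti₀ hx0 (hmin hs)⟩

/-- A bounded function on `(0, ∞)` with a quadratic expansion at `0` satisfies a global cubic
error bound. -/
lemma exists_forall_abs_sub_quadratic_le {f : ℝ → ℝ} {a b c B : ℝ}
    (hB : ∀ s, 0 < s → |f s| ≤ B)
    (h : (fun s => f s - (a + b * s + c * s ^ 2)) =O[nhds 0] fun s => s ^ 3) :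
    ∃ C : ℝ, ∀ s, 0 < s → |f s - (a + b * s + c * s ^ 2)| ≤ C * s ^ 3 := by
  obtain ⟨C, hC⟩ := h.bound
  obtain ⟨δ, hδ, hball⟩ := Metric.eventually_nhds_iff.1 hC
  refine ⟨max C ((B + |a|) / δ ^ 3 + |b| / δ ^ 2 + |c| / δ), fun s hs => ?_⟩
  have hs3 : 0 < s ^ 3 := by positivity
  rcases lt_or_ge s δ with hsδ | hsδ
  · have := hball (y := s) (by simpa [abs_of_pos hs] using hsδ)
    rw [Real.norm_eq_abs, Real.norm_of_nonneg hs3.le] at this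
    exact this.trans (by gcongr; exact le_max_left _ _)
  · have hB0 : 0 ≤ B := (abs_nonneg _).trans (hB s hs)
    have hr : 1 ≤ s / δ := (one_le_div hδ).2 hsδ
    calc |f s - (a + b * s + c * s ^ 2)|
        ≤ |f s| + (|a| + |b * s| + |c * s ^ 2|) :=
          (abs_sub _ _).trans (by gcongr; exact abs_add_three _ _ _)
      _ ≤ B + (|a| + |b| * s + |c| * s ^ 2) := by
          rw [abs_mul, abs_mul, abs_of_pos hs, abs_of_pos (pow_pos hs 2)]
          gcongr
          exact hB s hs
      _ = (B + |a|) * 1 + |b| * s * 1 + |c| * s ^ 2 * 1 := by ring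
      _ ≤ (B + |a|) * (s / δ) ^ 3 + |b| * s * (s / δ) ^ 2 + |c| * s ^ 2 * (s / δ) := by
          gcongr <;> exact one_le_pow₀ hr
      _ = ((B + |a|) / δ ^ 3 + |b| / δ ^ 2 + |c| / δ) * s ^ 3 := by
          field_simp
      _ ≤ _ := by gcongr; exact le_max_right _ _

lemma integrableOn_pow_mul_exp_neg_mul (n : ℕ) {L : ℝ} (hL : 0 < L) :
    IntegrableOn (fun s : ℝ => s ^ n * exp (-(L * s))) (Set.Ioi 0) := by
  have h : (-1 : ℝ) < n := by linarith [n.cast_nonneg (α := ℝ)]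
  simpa using integrableOn_rpow_mul_exp_neg_mul_rpow h one_pos hL

lemma integral_pow_mul_exp_neg_mul (n : ℕ) {L : ℝ} (hL : 0 < L) :
    ∫ s in Set.Ioi (0 : ℝ), s ^ n * exp (-(L * s)) = n.factorial / L ^ (n + 1) := by
  have h := integral_rpow_mul_exp_neg_mul_Ioi (a := (n + 1 : ℕ)) (by positivity) hL
  rw [rpow_natCast] at h
  simp only [Nat.cast_add, Nat.cast_one, add_sub_cancel_right, rpow_natCast,
    Gamma_nat_eq_factorial] at h
  rw [h, one_div, inv_pow]
  field_simp

/-- Watson's lemma with a quadratic expansion and a global cubic error bound. -/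
lemma abs_integral_mul_exp_sub_le {f : ℝ → ℝ} {a b c C L : ℝ} (hL : 0 < L)
    (hf : IntegrableOn (fun s => f s * exp (-(L * s))) (Set.Ioi 0))
    (h : ∀ s, 0 < s → |f s - (a + b * s + c * s ^ 2)| ≤ C * s ^ 3) :
    |(∫ s in Set.Ioi (0 : ℝ), f s * exp (-(L * s))) - a / L - b / L ^ 2 - 2 * c / L ^ 3|
      ≤ 6 * C / L ^ 4 := by
  have i0 := (integrableOn_pow_mul_exp_neg_mul 0 hL).const_mul a
  have i1 := (integrableOn_pow_mul_exp_neg_mul 1 hL).const_mul b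
  have i2 := (integrableOn_pow_mul_exp_neg_mul 2 hL).const_mul c
  have i3 := (integrableOn_pow_mul_exp_neg_mul 3 hL).const_mul C
  have e : (∫ s in Set.Ioi (0 : ℝ), f s * exp (-(L * s))) - a / L - b / L ^ 2 - 2 * c / L ^ 3
      = ∫ s in Set.Ioi (0 : ℝ), (f s * exp (-(L * s)) - a * (s ^ 0 * exp (-(L * s)))
        - b * (s ^ 1 * exp (-(L * s))) - c * (s ^ 2 * exp (-(L * s)))) := by
    rw [integral_sub (by exact (hf.sub i0).sub i1) i2,
      integral_sub (by exact hf.sub i0) i1, integral_sub hf i0]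
    simp only [integral_const_mul, integral_pow_mul_exp_neg_mul _ hL]
    norm_num
    ring
  have e3 : 6 * C / L ^ 4 = ∫ s in Set.Ioi (0 : ℝ), C * (s ^ 3 * exp (-(L * s))) := by
    rw [integral_const_mul, integral_pow_mul_exp_neg_mul _ hL]
    norm_num [Nat.factorial]
    ring
  rw [e, e3, ← Real.norm_eq_abs]
  refine norm_integral_le_of_norm_le i3 ?_
  filter_upwards [ae_restrict_mem measurableSet_Ioi] with s hs
  calc _ = |(f s - (a + b * s + c * s ^ 2)) * exp (-(L * s))| := by
        rw [Real.norm_eq_abs]; ring_nf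
    _ = |f s - (a + b * s + c * s ^ 2)| * exp (-(L * s)) := by
        rw [abs_mul, abs_of_pos (exp_pos _)]
    _ ≤ C * s ^ 3 * exp (-(L * s)) := by gcongr; exact h s hs
    _ = _ := by ring

lemma integrableOn_inv_Gamma_mul_exp {L : ℝ} (hL : 0 < L) :
    IntegrableOn (fun s : ℝ => (Gamma (s + 1))⁻¹ * exp (-(L * s))) (Set.Ioi 0) := by
  obtain ⟨B, hB⟩ := exists_inv_Gamma_le
  have hcont : ContinuousOn (fun s : ℝ => (Gamma (s + 1))⁻¹) (Set.Ioi 0) := by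
    refine ContinuousOn.inv₀ ?_ fun s hs => (Gamma_pos_of_pos (add_pos hs one_pos)).ne'
    exact differentiableOn_Gamma_Ioi.continuousOn.comp (by fun_prop)
      fun s hs => Set.mem_Ioi.2 (add_pos hs one_pos)
  have hi := integrableOn_pow_mul_exp_neg_mul 0 hL
  simp only [pow_zero, one_mul] at hi
  refine Integrable.bdd_mul (c := B) hi (hcont.aestronglyMeasurable measurableSet_Ioi) ?_
  filter_upwards [ae_restrict_mem measurableSet_Ioi] with s hs
  have hs1 : 0 < s + 1 := add_pos hs one_pos
  rw [Real.norm_of_nonneg (inv_nonneg.2 (Gamma_pos_of_pos hs1).le)]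
  exact hB _ hs1

lemma volterra_eq_integral_exp {x : ℝ} (hx : 0 < x) :
    volterra x = ∫ s in Set.Ioi (0 : ℝ), (Gamma (s + 1))⁻¹ * exp (-(log (1 / x) * s)) := by
  rw [volterra]
  congr 1
  ext s
  rw [rpow_def_of_pos hx, one_div, log_inv, neg_mul, neg_neg, div_eq_inv_mul]

/-- As `x → 0⁺`,
`ν(x) = 1/log(1/x) + γ_EM/(log(1/x))² + (γ_EM² − π²/6)/(log(1/x))³ + O(1/(log(1/x))⁴)`. -/
theorem volterra_asymptotics_zero :
    (fun x : ℝ => volterra x - 1 / Real.log (1 / x) - eulerGamma / (Real.log (1 / x)) ^ 2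
        - (eulerGamma ^ 2 - Real.pi ^ 2 / 6) / (Real.log (1 / x)) ^ 3)
      =O[nhdsWithin 0 (Set.Ioi 0)] (fun x : ℝ => 1 / (Real.log (1 / x)) ^ 4) := by
  obtain ⟨B, hB⟩ := exists_inv_Gamma_le
  obtain ⟨C, hC⟩ := exists_forall_abs_sub_quadratic_le (B := B) (fun s hs => by
    have hs1 : 0 < s + 1 := by linarith
    rw [abs_of_nonneg (inv_nonneg.2 (Gamma_pos_of_pos hs1).le)]
    exact hB _ hs1) inv_Gamma_add_one_sub_quadratic_isBigO
  refine IsBigO.of_bound (6 * C) ?_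
  filter_upwards [Ioo_mem_nhdsGT (zero_lt_one (α := ℝ))] with x hx
  have hL : 0 < Real.log (1 / x) := Real.log_pos ((one_lt_div hx.1).2 hx.2)
  have h := abs_integral_mul_exp_sub_le hL (integrableOn_inv_Gamma_mul_exp hL) hC
  rw [← volterra_eq_integral_exp hx.1, mul_div_cancel₀ _ (two_ne_zero (α := ℝ))] at h
  rw [Real.norm_eq_abs, Real.norm_of_nonneg (by positivity), mul_one_div]
  exact h
end

section
/- For all real x > 0, λ > 0 and z > 0, one has λ · ∫₀^x E(z/(x−y)) · ν′(λ y) dy = −1 − (log(zλ) + 2γ_EM) · ν(xλ) + λ · ∫₀^x Ẽ(z/(x−y)) · ν′(λ y) dy. -/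
open MeasureTheory Real

/-- The derivative of the Volterra function: `ν′(x) = ∫₀^∞ s x^{s−1} / Γ(s+1) ds` for `x > 0`. -/
noncomputable def volterraDeriv (x : ℝ) : ℝ :=
  ∫ s in Set.Ioi (0 : ℝ), s * x ^ (s - 1) / Real.Gamma (s + 1)

/-- The exponential integral `E(x) = ∫_x^∞ (e^{−y}/y) dy` for `x > 0`. -/
noncomputable def expInt (x : ℝ) : ℝ := ∫ y in Set.Ioi x, Real.exp (-y) / y

/-- The complementary exponential integral `Ẽ(x) = ∫₀^x ((1−e^{−y})/y) dy`. -/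
noncomputable def expIntC (x : ℝ) : ℝ := ∫ y in (0 : ℝ)..x, (1 - Real.exp (-y)) / y

open Filter Topology Set

lemma rpow_mul_exp_neg_le_Gamma {a s : ℝ} (ha : 0 < a) (hs : 0 ≤ s) :
    a ^ s * Real.exp (-a) ≤ Real.Gamma (s + 1) := by
  rw [Real.Gamma_eq_integral (by linarith), ← integral_exp_neg_Ioi a, ← integral_const_mul]
  have hFint := Real.GammaIntegral_convergent (s := s + 1) (by linarith)
  refine (setIntegral_mono_on ((integrableOn_exp_neg_Ioi a).const_mul _)
    (hFint.mono_set (Ioi_subset_Ioi ha.le)) measurableSet_Ioi fun x hx => ?_).trans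
    (setIntegral_mono_set hFint ?_ (Ioi_subset_Ioi ha.le).eventuallyLE)
  · rw [mul_comm, add_sub_cancel_right]
    gcongr
    exact (mem_Ioi.1 hx).le
  · filter_upwards [ae_restrict_mem measurableSet_Ioi] with x hx
    have : 0 < x := hx
    positivity

lemma rpow_div_Gamma_le {X s : ℝ} (hX : 0 < X) (hs : 0 ≤ s) :
    X ^ s / Real.Gamma (s + 1) ≤ Real.exp (Real.exp 1 * X) * Real.exp (-s) := by
  have hG : 0 < Real.Gamma (s + 1) := Real.Gamma_pos_of_pos (by linarith)
  have h := rpow_mul_exp_neg_le_Gamma (a := Real.exp 1 * X) (by positivity) hs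
  rw [Real.mul_rpow (by positivity) hX.le, Real.exp_one_rpow] at h
  rw [div_le_iff₀ hG]
  calc X ^ s = Real.exp (Real.exp 1 * X) * Real.exp (-s) *
        (Real.exp s * X ^ s * Real.exp (-(Real.exp 1 * X))) := by
        rw [Real.exp_neg, Real.exp_neg]; field_simp
    _ ≤ _ := by gcongr

lemma hasDerivAt_rpow_div_Gamma {X s : ℝ} (hX : 0 < X) (hs : 0 ≤ s) :
    HasDerivAt (fun s => X ^ s / Real.Gamma (s + 1))
      (X ^ s / Real.Gamma (s + 1) *
        (Real.log X - deriv Real.Gamma (s + 1) / Real.Gamma (s + 1))) s := by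
  have hG : 0 < Real.Gamma (s + 1) := Real.Gamma_pos_of_pos (by linarith)
  have hd : DifferentiableAt ℝ Real.Gamma (s + 1) := by
    refine Real.differentiableAt_Gamma fun m => ?_
    have : (0 : ℝ) ≤ m := m.cast_nonneg
    linarith
  have h2 := hd.hasDerivAt.comp_add_const s 1
  convert! (Real.hasStrictDerivAt_const_rpow hX s).hasDerivAt.fun_div h2 hG.ne' using 1
  field_simp

lemma integrableOn_rpow_div_Gamma {X : ℝ} (hX : 0 < X) :
    IntegrableOn (fun s => X ^ s / Real.Gamma (s + 1)) (Ioi 0) := by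
  refine ((integrableOn_exp_neg_Ioi 0).const_mul (Real.exp (Real.exp 1 * X))).mono' ?_ ?_
  · refine ContinuousOn.aestronglyMeasurable (fun s hs => ?_) measurableSet_Ioi
    exact (hasDerivAt_rpow_div_Gamma hX (le_of_lt hs)).continuousAt.continuousWithinAt
  · filter_upwards [ae_restrict_mem measurableSet_Ioi] with s hs
    have hs : 0 < s := hs
    have hG : 0 < Real.Gamma (s + 1) := Real.Gamma_pos_of_pos (by linarith)
    rw [Real.norm_of_nonneg (by positivity)]
    exact rpow_div_Gamma_le hX hs.le

lemma tendsto_rpow_div_Gamma {X : ℝ} (hX : 0 < X) :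
    Tendsto (fun s => X ^ s / Real.Gamma (s + 1)) atTop (𝓝 0) := by
  have h : Tendsto (fun s => Real.exp (Real.exp 1 * X) * Real.exp (-s)) atTop (𝓝 0) := by
    simpa using (Real.tendsto_exp_neg_atTop_nhds_zero).const_mul (Real.exp (Real.exp 1 * X))
  refine squeeze_zero' ?_ ?_ h
  · filter_upwards [eventually_ge_atTop 0] with s hs
    have hG : 0 < Real.Gamma (s + 1) := Real.Gamma_pos_of_pos (by linarith)
    positivity
  · filter_upwards [eventually_ge_atTop 0] with s hs using rpow_div_Gamma_le hX hs

/-- Nonnegativity of the weight makes the derivative of `s ↦ X ^ s / Γ(s + 1)` integrable. -/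
lemma integral_rpow_div_Gamma_mul_harmonic {X c : ℝ} (hX : 0 < X)
    (hc : ∀ s > 0, 0 ≤ deriv Real.Gamma (s + 1) / Real.Gamma (s + 1) + c) :
    IntegrableOn (fun s => X ^ s / Real.Gamma (s + 1) *
        (deriv Real.Gamma (s + 1) / Real.Gamma (s + 1) + c)) (Ioi 0) ∧
      ∫ s in Ioi (0 : ℝ), X ^ s / Real.Gamma (s + 1) *
        (deriv Real.Gamma (s + 1) / Real.Gamma (s + 1) + c)
        = (Real.log X + c) * volterra X + 1 := by
  set g : ℝ → ℝ := fun s => X ^ s / Real.Gamma (s + 1) with hg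
  have hgi : IntegrableOn g (Ioi 0) := integrableOn_rpow_div_Gamma hX
  have hgc : ContinuousOn g (Ici 0) := fun s hs =>
    (hasDerivAt_rpow_div_Gamma hX hs).continuousAt.continuousWithinAt
  have hcont : ContinuousWithinAt
      (fun s => (Real.log X + c) * (∫ t in (0 : ℝ)..s, g t) - g s) (Ici 0) 0 := by
    refine ContinuousWithinAt.sub (ContinuousWithinAt.const_mul ?_ _) (hgc 0 self_mem_Ici)
    have := intervalIntegral.continuousOn_primitive_interval (μ := volume) (f := g) (a := 0)
      (b := 1) (by
        rw [uIcc_of_le zero_le_one]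
        exact (hgc.mono Icc_subset_Ici_self).integrableOn_Icc)
    rw [uIcc_of_le zero_le_one] at this
    exact (this 0 (by simp)).mono_of_mem_nhdsWithin (Icc_mem_nhdsGE zero_lt_one)
  have hderiv : ∀ s ∈ Ioi (0 : ℝ), HasDerivAt
      (fun s => (Real.log X + c) * (∫ t in (0 : ℝ)..s, g t) - g s)
      (g s * (deriv Real.Gamma (s + 1) / Real.Gamma (s + 1) + c)) s := by
    intro s hs
    have hs : 0 < s := hs
    have h1 : HasDerivAt (fun s => ∫ t in (0 : ℝ)..s, g t) (g s) s := by
      refine intervalIntegral.integral_hasDerivAt_right ?_ ?_ ?_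
      · refine (hgc.mono ?_).intervalIntegrable
        rw [uIcc_of_le hs.le]
        exact Icc_subset_Ici_self
      · exact (hgc.mono Ioi_subset_Ici_self).stronglyMeasurableAtFilter isOpen_Ioi s hs
      · exact (hgc.continuousAt (Ici_mem_nhds hs))
    convert! (h1.const_mul (Real.log X + c)).sub (hasDerivAt_rpow_div_Gamma hX hs.le) using 1
    simp only [hg]
    ring
  have hpos : ∀ s ∈ Ioi (0 : ℝ),
      0 ≤ g s * (deriv Real.Gamma (s + 1) / Real.Gamma (s + 1) + c) := fun s hs => by
    have hs : 0 < s := hs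
    have hG : 0 < Real.Gamma (s + 1) := Real.Gamma_pos_of_pos (by linarith)
    exact mul_nonneg (by positivity) (hc s hs)
  have hlim : Tendsto (fun s => (Real.log X + c) * (∫ t in (0 : ℝ)..s, g t) - g s) atTop
      (𝓝 ((Real.log X + c) * volterra X - 0)) :=
    ((intervalIntegral_tendsto_integral_Ioi 0 hgi tendsto_id).const_mul _).sub
      (tendsto_rpow_div_Gamma hX)
  refine ⟨integrableOn_Ioi_deriv_of_nonneg hcont hderiv hpos hlim, ?_⟩
  rw [integral_Ioi_of_hasDerivAt_of_nonneg hcont hderiv hpos hlim]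
  simp [hg]

lemma hasDerivAt_Gamma_one_eulerGamma : HasDerivAt Real.Gamma (-eulerGamma) 1 := by
  have h := Complex.hasDerivAt_GammaIntegral (s := 1) (by simp)
  have h2 : HasDerivAt Complex.Gamma _ 1 := h.congr_of_eventuallyEq <| by
    filter_upwards [(isOpen_lt continuous_const Complex.continuous_re).mem_nhds
      (show (1 : ℂ) ∈ {z : ℂ | 0 < z.re} by simp)] with z hz
    exact Complex.Gamma_eq_integral hz
  have h3 := HasDerivAt.real_of_complex (z := 1) (by simpa using h2)
  convert! h3 using 1
  rw [eulerGamma, neg_neg, ← Complex.ofReal_re (∫ x in Ioi (0 : ℝ), _), ← integral_complex_ofReal]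
  congr 1
  refine setIntegral_congr_fun measurableSet_Ioi fun x hx => ?_
  simp [mul_comm]

/-- The derivative of the Beta integral in its first variable at `1`. -/
lemma integral_log_mul_one_sub_rpow {s : ℝ} (hs : 0 < s) :
    IntegrableOn (fun t => Real.log t * (s * (1 - t) ^ (s - 1))) (Ioo 0 1) ∧
      ∫ t in Ioo (0 : ℝ) 1, Real.log t * (s * (1 - t) ^ (s - 1))
        = -(deriv Real.Gamma (s + 1) / Real.Gamma (s + 1) + eulerGamma) := by
  set f : ℝ → ℂ := (Ioo (0 : ℝ) 1).indicator fun t => (1 - (t : ℂ)) ^ ((s : ℂ) - 1) with hf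
  have hfi : Integrable f := by
    rw [hf, integrable_indicator_iff measurableSet_Ioo]
    have := Complex.betaIntegral_convergent (u := 1) (v := s) (by simp) (by simpa)
    rw [intervalIntegrable_iff_integrableOn_Ioo_of_le zero_le_one] at this
    simpa using this
  have hbeta : ∀ a : ℂ, mellin f a = Complex.betaIntegral a s := by
    intro a
    rw [mellin, Complex.betaIntegral, intervalIntegral.integral_of_le zero_le_one,
      integral_Ioc_eq_integral_Ioo, ← integral_indicator measurableSet_Ioi,
      ← integral_indicator measurableSet_Ioo]
    congr 1
    ext t
    by_cases ht : t ∈ Ioo (0 : ℝ) 1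
    · have h0 : t ∈ Ioi (0 : ℝ) := ht.1
      simp [hf, ht, ht.1]
    · simp [hf, ht, Set.indicator]
  have htop : f =O[atTop] (· ^ (-2 : ℝ)) := by
    refine Asymptotics.IsBigO.congr' (Asymptotics.isBigO_zero (E' := ℂ) _ _) ?_ EventuallyEq.rfl
    filter_upwards [eventually_ge_atTop 1] with t ht
    simp [hf, not_lt.2 ht]
  have hbot : f =O[𝓝[>] 0] (· ^ (-0 : ℝ)) := by
    have hc : ContinuousAt (fun t : ℝ => (1 - (t : ℂ)) ^ ((s : ℂ) - 1)) 0 := by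
      refine ContinuousAt.cpow (by fun_prop) (by fun_prop) (by simp)
    have := (hc.tendsto.isBigO_one ℝ).mono (nhdsWithin_le_nhds (s := Ioi 0))
    refine this.congr' ?_ ?_
    · filter_upwards [Ioo_mem_nhdsGT (zero_lt_one (α := ℝ))] with t ht
      simp [hf, ht.1, ht.2]
    · exact Eventually.of_forall fun t => by simp
  obtain ⟨hconv, hder⟩ := mellin_hasDerivAt_of_isBigO_rpow (s := 1)
    (hfi.locallyIntegrable.locallyIntegrableOn _) htop (by simp) hbot (by simp)
  have hfun : ∀ t : ℝ, (Ioi (0 : ℝ)).indicator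
      (fun t : ℝ => (t : ℂ) ^ ((1 : ℂ) - 1) • (fun t => Real.log t • f t) t) t
      = (Ioo (0 : ℝ) 1).indicator
        (fun t => ((Real.log t * (1 - t) ^ (s - 1) : ℝ) : ℂ)) t := by
    intro t
    by_cases ht : t ∈ Ioo (0 : ℝ) 1
    · have h0 : t ∈ Ioi (0 : ℝ) := ht.1
      rw [indicator_of_mem h0, indicator_of_mem ht]
      simp only [hf, indicator_of_mem ht]
      rw [Complex.ofReal_mul, Complex.ofReal_cpow (by linarith [ht.2])]
      simp
    · simp [hf, ht, Set.indicator]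
  rw [MellinConvergent, ← integrable_indicator_iff measurableSet_Ioi, funext hfun,
    integrable_indicator_iff measurableSet_Ioo] at hconv
  have hreal : IntegrableOn (fun t => Real.log t * (1 - t) ^ (s - 1)) (Ioo 0 1) := by
    have h := hconv.re
    simpa [IntegrableOn] using h
  have hval : (mellin (fun t => Real.log t • f t) 1)
      = ((∫ t in Ioo (0 : ℝ) 1, Real.log t * (1 - t) ^ (s - 1) : ℝ) : ℂ) := by
    rw [mellin, ← integral_indicator measurableSet_Ioi, integral_congr_ae (ae_of_all _ hfun),
      integral_indicator measurableSet_Ioo, integral_complex_ofReal]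
  rw [funext hbeta, hval] at hder
  have hd1 := HasDerivAt.real_of_complex (z := 1) (by simpa using hder)
  have hG : 0 < Real.Gamma s := Real.Gamma_pos_of_pos hs
  have hG1 : 0 < Real.Gamma (1 + s) := Real.Gamma_pos_of_pos (by linarith)
  have hd : DifferentiableAt ℝ Real.Gamma (1 + s) := by
    refine Real.differentiableAt_Gamma fun m => ?_
    have : (0 : ℝ) ≤ m := m.cast_nonneg
    linarith
  have hd2 := (hasDerivAt_Gamma_one_eulerGamma.mul_const (Real.Gamma s)).fun_div
    (hd.hasDerivAt.comp_add_const 1 s) hG1.ne'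
  have heq : (fun x : ℝ => (Complex.betaIntegral x s).re) =ᶠ[𝓝 1]
      fun a => Real.Gamma a * Real.Gamma s / Real.Gamma (a + s) := by
    filter_upwards [Ioi_mem_nhds zero_lt_one] with a ha
    have h := Complex.betaIntegral_eq_Gamma_mul_div (a : ℂ) s (by simpa using ha) (by simpa)
    rw [h, Complex.Gamma_ofReal, Complex.Gamma_ofReal, ← Complex.ofReal_add,
      Complex.Gamma_ofReal]
    norm_cast
  have hR := hd1.unique (hd2.congr_of_eventuallyEq heq)
  simp only [Complex.ofReal_re] at hR
  have hmul : (fun t => Real.log t * (s * (1 - t) ^ (s - 1)))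
      = fun t => s * (Real.log t * (1 - t) ^ (s - 1)) := by ext t; ring
  rw [hmul]
  refine ⟨hreal.const_mul s, ?_⟩
  rw [integral_const_mul, hR, add_comm s 1]
  have hsG : Real.Gamma (1 + s) = s * Real.Gamma s := by
    rw [add_comm, Real.Gamma_add_one hs.ne']
  rw [Real.Gamma_one]
  field_simp
  rw [hsG]
  ring

lemma integral_log_one_sub_mul_rpow {s : ℝ} (hs : 0 < s) :
    IntegrableOn (fun t => Real.log (1 - t) * (s * t ^ (s - 1))) (Ioo 0 1) ∧
      ∫ t in Ioo (0 : ℝ) 1, Real.log (1 - t) * (s * t ^ (s - 1))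
        = -(deriv Real.Gamma (s + 1) / Real.Gamma (s + 1) + eulerGamma) := by
  obtain ⟨h1, h2⟩ := integral_log_mul_one_sub_rpow hs
  rw [← integral_Ioc_eq_integral_Ioo, ← intervalIntegral.integral_of_le zero_le_one] at h2 ⊢
  rw [← intervalIntegrable_iff_integrableOn_Ioo_of_le zero_le_one] at h1 ⊢
  constructor
  · simpa using (h1.comp_sub_left 1).symm
  · rw [← h2]
    simpa using intervalIntegral.integral_comp_sub_left (a := 0) (b := 1)
      (fun t => Real.log t * (s * (1 - t) ^ (s - 1))) (1 : ℝ)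

lemma integral_weight_mul_volterraDeriv {X : ℝ} (hX : 0 < X) {w K : ℝ → ℝ}
    (hwc : ContinuousOn w (Ioo 0 1)) (hw0 : ∀ v ∈ Ioo (0 : ℝ) 1, 0 ≤ w v)
    (hwi : ∀ s > 0, IntegrableOn (fun v => w v * (s * v ^ (s - 1))) (Ioo 0 1))
    (hK : ∀ s > 0, ∫ v in Ioo (0 : ℝ) 1, w v * (s * v ^ (s - 1)) = K s)
    (hKi : IntegrableOn (fun s => X ^ s / Real.Gamma (s + 1) * K s) (Ioi 0)) :
    IntegrableOn (fun v => w v * (X * volterraDeriv (X * v))) (Ioo 0 1) ∧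
      ∫ v in Ioo (0 : ℝ) 1, w v * (X * volterraDeriv (X * v))
        = ∫ s in Ioi (0 : ℝ), X ^ s / Real.Gamma (s + 1) * K s := by
  set F : ℝ → ℝ → ℝ := fun v s => X ^ s / Real.Gamma (s + 1) * (w v * (s * v ^ (s - 1))) with hF
  have hinner : ∀ v ∈ Ioo (0 : ℝ) 1,
      ∫ s in Ioi (0 : ℝ), F v s = w v * (X * volterraDeriv (X * v)) := by
    intro v hv
    rw [volterraDeriv, ← integral_const_mul, ← integral_const_mul]
    refine integral_congr_ae (ae_of_all _ fun s => ?_)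
    simp only [hF]
    rw [Real.mul_rpow hX.le hv.1.le, show X ^ s = X * X ^ (s - 1) by
      rw [Real.rpow_sub_one hX.ne']; field_simp]
    ring
  have houter : ∀ s ∈ Ioi (0 : ℝ),
      ∫ v in Ioo (0 : ℝ) 1, F v s = X ^ s / Real.Gamma (s + 1) * K s := by
    intro s hs
    rw [← hK s hs, ← integral_const_mul]
  have hmeas : AEStronglyMeasurable (Function.uncurry F)
      ((volume.restrict (Ioo (0 : ℝ) 1)).prod (volume.restrict (Ioi (0 : ℝ)))) := by
    rw [Measure.prod_restrict]
    refine ContinuousOn.aestronglyMeasurable ?_ (measurableSet_Ioo.prod measurableSet_Ioi)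
    have h1 : ContinuousOn (fun p : ℝ × ℝ => X ^ p.2 / Real.Gamma (p.2 + 1))
        (Ioo (0 : ℝ) 1 ×ˢ Ioi (0 : ℝ)) := by
      refine ContinuousOn.comp (g := fun s => X ^ s / Real.Gamma (s + 1)) (t := Ioi 0)
        (fun s hs => ?_) continuous_snd.continuousOn fun p hp => hp.2
      exact (hasDerivAt_rpow_div_Gamma hX (le_of_lt hs)).continuousAt.continuousWithinAt
    have h2 : ContinuousOn (fun p : ℝ × ℝ => w p.1) (Ioo (0 : ℝ) 1 ×ˢ Ioi (0 : ℝ)) :=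
      hwc.comp continuous_fst.continuousOn fun p hp => hp.1
    refine h1.mul (h2.mul (continuous_snd.continuousOn.mul ?_))
    exact continuous_fst.continuousOn.rpow (by fun_prop) fun p hp => Or.inl hp.1.1.ne'
  have hFint : Integrable (Function.uncurry F)
      ((volume.restrict (Ioo (0 : ℝ) 1)).prod (volume.restrict (Ioi (0 : ℝ)))) := by
    rw [integrable_prod_iff' hmeas]
    constructor
    · filter_upwards [ae_restrict_mem measurableSet_Ioi] with s hs
      exact (hwi s hs).const_mul (X ^ s / Real.Gamma (s + 1))
    · refine hKi.congr_fun (fun s hs => ?_) measurableSet_Ioi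
      refine (houter s hs).symm.trans ?_
      refine setIntegral_congr_fun measurableSet_Ioo fun v hv => ?_
      have hs : 0 < s := hs
      have hv0 := hv.1
      have hG : 0 < Real.Gamma (s + 1) := Real.Gamma_pos_of_pos (by linarith)
      have := hw0 v hv
      simp only [Function.uncurry, hF]
      rw [Real.norm_of_nonneg (by positivity)]
  constructor
  · exact (integrableOn_congr_fun hinner measurableSet_Ioo).1 hFint.integral_prod_left
  · rw [← setIntegral_congr_fun measurableSet_Ioo hinner,
      ← setIntegral_congr_fun measurableSet_Ioi houter]
    exact integral_integral_swap hFint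

lemma integral_mul_rpow_sub_one {s : ℝ} (hs : 0 < s) :
    IntegrableOn (fun v => s * v ^ (s - 1)) (Ioo 0 1) ∧
      ∫ v in Ioo (0 : ℝ) 1, s * v ^ (s - 1) = 1 := by
  rw [← integral_Ioc_eq_integral_Ioo, ← intervalIntegral.integral_of_le zero_le_one,
    ← intervalIntegrable_iff_integrableOn_Ioo_of_le zero_le_one]
  refine ⟨(intervalIntegral.intervalIntegrable_rpow' (by linarith)).const_mul s, ?_⟩
  rw [intervalIntegral.integral_const_mul, integral_rpow (Or.inl (by linarith))]
  simp [hs.ne']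

lemma integral_volterraDeriv {X : ℝ} (hX : 0 < X) :
    IntegrableOn (fun v => X * volterraDeriv (X * v)) (Ioo 0 1) ∧
      ∫ v in Ioo (0 : ℝ) 1, X * volterraDeriv (X * v) = volterra X := by
  have h := integral_weight_mul_volterraDeriv hX (w := fun _ => 1) (K := fun _ => 1)
    continuousOn_const (fun _ _ => zero_le_one)
    (fun s hs => by simpa using (integral_mul_rpow_sub_one hs).1)
    (fun s hs => by simpa using (integral_mul_rpow_sub_one hs).2)
    (by simpa using integrableOn_rpow_div_Gamma hX)
  simpa [volterra] using h

lemma integral_log_one_sub_mul_volterraDeriv {X : ℝ} (hX : 0 < X) :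
    IntegrableOn (fun v => Real.log (1 - v) * (X * volterraDeriv (X * v))) (Ioo 0 1) ∧
      ∫ v in Ioo (0 : ℝ) 1, Real.log (1 - v) * (X * volterraDeriv (X * v))
        = -((Real.log X + eulerGamma) * volterra X + 1) := by
  have hw0 : ∀ v ∈ Ioo (0 : ℝ) 1, 0 ≤ -Real.log (1 - v) := fun v hv =>
    neg_nonneg.2 (Real.log_nonpos (by linarith [hv.2]) (by linarith [hv.1]))
  have hK : ∀ s > 0, ∫ v in Ioo (0 : ℝ) 1, -Real.log (1 - v) * (s * v ^ (s - 1))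
      = deriv Real.Gamma (s + 1) / Real.Gamma (s + 1) + eulerGamma := fun s hs => by
    simp only [neg_mul]
    rw [integral_neg, (integral_log_one_sub_mul_rpow hs).2, neg_neg]
  obtain ⟨hKi, hKv⟩ := integral_rpow_div_Gamma_mul_harmonic hX (c := eulerGamma) fun s hs => by
    rw [← hK s hs]
    refine setIntegral_nonneg measurableSet_Ioo fun v hv => ?_
    have := hw0 v hv
    have := hv.1
    have hs : 0 < s := hs
    positivity
  obtain ⟨h1, h2⟩ := integral_weight_mul_volterraDeriv hX (w := fun v => -Real.log (1 - v))
    (ContinuousOn.neg (ContinuousOn.log (by fun_prop) fun v hv => (sub_pos.2 hv.2).ne')) hw0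
    (fun s hs => by simpa using (integral_log_one_sub_mul_rpow hs).1.neg) hK hKi
  rw [hKv] at h2
  simp only [neg_mul, integral_neg] at h1 h2
  exact ⟨by simpa using h1.neg, by linarith⟩

lemma integrableOn_exp_neg_div {t : ℝ} (ht : 0 < t) :
    IntegrableOn (fun x => Real.exp (-x) / x) (Ioi t) := by
  refine ((integrableOn_exp_neg_Ioi t).const_mul t⁻¹).mono' ?_ ?_
  · refine ContinuousOn.aestronglyMeasurable ?_ measurableSet_Ioi
    exact ContinuousOn.div (by fun_prop) continuousOn_id fun x hx => (ht.trans hx).ne'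
  · filter_upwards [ae_restrict_mem measurableSet_Ioi] with x hx
    have hx' : t < x := hx
    have : 0 < x := ht.trans hx
    rw [Real.norm_of_nonneg (by positivity), div_eq_inv_mul]
    gcongr

lemma integrableOn_exp_neg_mul_log {t : ℝ} (ht : 0 < t) :
    IntegrableOn (fun x => Real.exp (-x) * Real.log x) (Ioi t) := by
  refine integrable_of_isBigO_exp_neg (b := 1 / 2) (by norm_num) ?_ ?_
  · exact ContinuousOn.mul (by fun_prop)
      (continuousOn_id.log fun x hx => (ht.trans_le hx).ne')
  · have h1 : (fun x => Real.log x) =O[atTop] fun x => Real.exp (1 / 2 * x) :=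
      Real.isLittleO_log_id_atTop.isBigO.trans
        (by simpa [Function.id_def] using
          (isLittleO_pow_exp_pos_mul_atTop 1 (b := 1 / 2) (by norm_num)).isBigO)
    refine ((Asymptotics.isBigO_refl (fun x : ℝ => Real.exp (-x)) atTop).mul h1).congr_right
      fun x => ?_
    rw [← Real.exp_add]
    ring_nf

lemma expInt_eq_expIntC_sub_log {t : ℝ} (ht : 0 < t) :
    expInt t = expIntC t - Real.log t - eulerGamma := by
  have hlog : IntervalIntegrable (fun x => Real.exp (-x) * Real.log x) volume 0 t :=
    intervalIntegral.intervalIntegrable_log'.continuousOn_mul (by fun_prop)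
  have hcomp : IntervalIntegrable (fun x => (1 - Real.exp (-x)) / x) volume 0 t := by
    rw [intervalIntegrable_iff_integrableOn_Ioo_of_le ht.le]
    refine Measure.integrableOn_of_bounded (M := 1) (by simp) ?_ ?_
    · exact (Measurable.aestronglyMeasurable (by fun_prop))
    · filter_upwards [ae_restrict_mem measurableSet_Ioo] with x hx
      have h1 := Real.add_one_le_exp (-x)
      have h2 : Real.exp (-x) ≤ 1 := Real.exp_le_one_iff.2 (by linarith [hx.1])
      rw [Real.norm_of_nonneg (div_nonneg (by linarith) hx.1.le), div_le_one hx.1]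
      linarith
  have hnear : (∫ x in (0 : ℝ)..t, Real.exp (-x) * Real.log x)
      = (1 - Real.exp (-t)) * Real.log t - expIntC t := by
    have h := intervalIntegral.integral_eq_sub_of_hasDerivAt_of_tendsto ht
      (f := fun x => (1 - Real.exp (-x)) * Real.log x)
      (f' := fun x => Real.exp (-x) * Real.log x + (1 - Real.exp (-x)) / x)
      (fa := 0) (fb := (1 - Real.exp (-t)) * Real.log t)
      (fun x hx => by
        have h1 : HasDerivAt (fun x => 1 - Real.exp (-x)) (Real.exp (-x)) x := by
          simpa using ((hasDerivAt_neg x).exp).const_sub 1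
        exact h1.mul (Real.hasDerivAt_log hx.1.ne'))
      (hlog.add hcomp) ?_ ?_
    · rw [intervalIntegral.integral_add hlog hcomp, sub_zero] at h
      rw [expIntC]
      linarith
    · have h0 : Tendsto (fun x => ‖Real.log x * x‖) (𝓝[>] 0) (𝓝 0) := by
        simpa using (tendsto_log_mul_rpow_nhdsGT_zero zero_lt_one).norm
      refine squeeze_zero_norm' ?_ h0
      filter_upwards [self_mem_nhdsWithin] with x hx
      have hx : 0 < x := hx
      have h1 := Real.add_one_le_exp (-x)
      have h2 : Real.exp (-x) ≤ 1 := Real.exp_le_one_iff.2 (by linarith)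
      rw [norm_mul, norm_mul, mul_comm, Real.norm_of_nonneg (sub_nonneg.2 h2),
        Real.norm_of_nonneg hx.le]
      gcongr
      linarith
    · refine ContinuousAt.tendsto (ContinuousAt.mul (by fun_prop) ?_) |>.mono_left
        nhdsWithin_le_nhds
      exact Real.continuousAt_log ht.ne'
  have hfar : (∫ x in Ioi t, Real.exp (-x) * Real.log x)
      = Real.exp (-t) * Real.log t + expInt t := by
    have hi1 := integrableOn_exp_neg_mul_log ht
    have hi2 := integrableOn_exp_neg_div ht
    have h := integral_Ioi_of_hasDerivAt_of_tendsto' (a := t) (m := 0)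
      (f := fun x => Real.exp (-x) * Real.log x)
      (f' := fun x => Real.exp (-x) / x - Real.exp (-x) * Real.log x)
      (fun x hx => by
        have h1 : HasDerivAt (fun x => Real.exp (-x)) (-Real.exp (-x)) x := by
          simpa using (hasDerivAt_neg x).exp
        convert! h1.mul (Real.hasDerivAt_log (ht.trans_le hx).ne') using 1
        ring)
      (hi2.sub hi1) ?_
    · rw [integral_sub hi2 hi1] at h
      rw [expInt]
      linarith
    · have h1 : (fun x => Real.log x) =o[atTop] fun x => Real.exp x :=
        Real.isLittleO_log_id_atTop.trans 
        (by simpa [Function.id_def] using isLittleO_pow_exp_atTop (n := 1))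
      refine h1.tendsto_div_nhds_zero.congr fun x => ?_
      rw [Real.exp_neg]
      ring
  have hunion : (∫ x in Ioi (0 : ℝ), Real.exp (-x) * Real.log x)
      = (∫ x in (0 : ℝ)..t, Real.exp (-x) * Real.log x)
        + ∫ x in Ioi t, Real.exp (-x) * Real.log x := by
    have hi0 := (intervalIntegrable_iff_integrableOn_Ioc_of_le ht.le).1 hlog
    rw [intervalIntegral.integral_of_le ht.le, ← setIntegral_union (Ioc_disjoint_Ioi le_rfl)
      measurableSet_Ioi hi0 (integrableOn_exp_neg_mul_log ht), Ioc_union_Ioi_eq_Ioi ht.le]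
  rw [eulerGamma, hunion, hnear, hfar]
  ring

lemma expInt_antitoneOn : AntitoneOn expInt (Ioi 0) := fun a ha b _ hab => by
  refine setIntegral_mono_set (integrableOn_exp_neg_div ha) ?_
    (Ioi_subset_Ioi hab).eventuallyLE
  filter_upwards [ae_restrict_mem measurableSet_Ioi] with x hx
  have : 0 < x := lt_trans ha hx
  positivity

lemma expInt_nonneg {t : ℝ} (ht : 0 < t) : 0 ≤ expInt t :=
  setIntegral_nonneg measurableSet_Ioi fun x hx => by
    have : 0 < x := ht.trans hx
    positivity

lemma integrableOn_expInt_mul {c : ℝ} (hc : 0 < c) {h : ℝ → ℝ} (hh : IntegrableOn h (Ioo 0 1)) :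
    IntegrableOn (fun v => expInt (c / (1 - v)) * h v) (Ioo 0 1) := by
  refine hh.bdd_mul (c := expInt c) ?_ ?_
  · refine (aemeasurable_restrict_of_antitoneOn measurableSet_Ioo
      fun a ha b hb hab => ?_).aestronglyMeasurable
    have h1 : 0 < 1 - a := sub_pos.2 ha.2
    have h2 : 0 < 1 - b := sub_pos.2 hb.2
    exact expInt_antitoneOn (div_pos hc h1) (div_pos hc h2) (by gcongr)
  · filter_upwards [ae_restrict_mem measurableSet_Ioo] with v hv
    have h1 : 0 < 1 - v := sub_pos.2 hv.2
    rw [Real.norm_of_nonneg (expInt_nonneg (div_pos hc h1))]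
    refine expInt_antitoneOn hc (div_pos hc h1) ?_
    rw [le_div_iff₀ h1]
    nlinarith [hv.1]

lemma mul_integral_convolution_eq (x lam z : ℝ) (F : ℝ → ℝ) :
    lam * (∫ y in (0 : ℝ)..x, F (z / (x - y)) * volterraDeriv (lam * y))
      = ∫ v in Ioo (0 : ℝ) 1,
          F (z / x / (1 - v)) * (x * lam * volterraDeriv (x * lam * v)) := by
  have h := intervalIntegral.mul_integral_comp_mul_left (a := 0) (b := 1) (c := x)
    (f := fun y => F (z / (x - y)) * volterraDeriv (lam * y))
  rw [mul_zero, mul_one] at h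
  rw [← h, ← mul_assoc, ← integral_Ioc_eq_integral_Ioo,
    ← intervalIntegral.integral_of_le zero_le_one, ← intervalIntegral.integral_const_mul]
  refine intervalIntegral.integral_congr fun v _ => ?_
  have e1 : z / (x - x * v) = z / x / (1 - v) := by
    rw [div_div, mul_sub, mul_one]
  have e2 : lam * (x * v) = x * lam * v := by ring
  simp only [e1, e2]
  ring

/-- For all `x, λ, z > 0`:
`λ ∫₀^x E(z/(x−y)) ν′(λ y) dy = −1 − (log(zλ) + 2γ_EM) ν(xλ) + λ ∫₀^x Ẽ(z/(x−y)) ν′(λ y) dy`. -/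
theorem expInt_volterraDeriv_convolution (x lam z : ℝ) (hx : 0 < x) (hlam : 0 < lam)
    (hz : 0 < z) :
    lam * (∫ y in (0 : ℝ)..x, expInt (z / (x - y)) * volterraDeriv (lam * y))
      = -1 - (Real.log (z * lam) + 2 * eulerGamma) * volterra (x * lam)
        + lam * (∫ y in (0 : ℝ)..x, expIntC (z / (x - y)) * volterraDeriv (lam * y)) := by
  have hX : 0 < x * lam := mul_pos hx hlam
  rw [mul_integral_convolution_eq, mul_integral_convolution_eq]
  obtain ⟨hi, hv⟩ := integral_volterraDeriv hX
  obtain ⟨hli, hlv⟩ := integral_log_one_sub_mul_volterraDeriv hX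
  have hE := integrableOn_expInt_mul (div_pos hz hx) hi
  have hci := hi.const_mul (Real.log z - Real.log x + eulerGamma)
  have hC : ∫ v in Ioo (0 : ℝ) 1,
      expIntC (z / x / (1 - v)) * (x * lam * volterraDeriv (x * lam * v))
      = ∫ v in Ioo (0 : ℝ) 1,
        (expInt (z / x / (1 - v)) * (x * lam * volterraDeriv (x * lam * v))
          + (Real.log z - Real.log x + eulerGamma) * (x * lam * volterraDeriv (x * lam * v))
          - Real.log (1 - v) * (x * lam * volterraDeriv (x * lam * v))) := by
    refine setIntegral_congr_fun measurableSet_Ioo fun v hv => ?_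
    have h1 : 0 < 1 - v := sub_pos.2 hv.2
    have h2 : 0 < z / x := div_pos hz hx
    rw [expInt_eq_expIntC_sub_log (div_pos h2 h1), Real.log_div h2.ne' h1.ne',
      Real.log_div hz.ne' hx.ne']
    ring
  rw [hC, integral_sub (hE.fun_add hci) hli, integral_add hE hci, integral_const_mul, hv, hlv,
    Real.log_mul hz.ne' hlam.ne', Real.log_mul hx.ne' hlam.ne']
  ring
end
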